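/- Let H be an associative unital k-algebra, U a k-vector space with distinguished element 1_U, and let J, T, γ, η be linear maps satisfying the L-R-crossed product axioms (5), (6), (7), (8), (9), (10), (11), (12), (13) (the unit axioms (1)-(4) are not needed). Then the L-R-crossed product multiplication on U⊗H is associative: [(u⊗h)(u'⊗h')](u''⊗h'') = (u⊗h)[(u'⊗h')(u''⊗h'')] for all u,u',u'' ∈ U and h,h',h'' ∈ H. -/

import Mathlib

open TensorProduct LinearMap

noncomputable section

variable {k : Type*} [Field k]

section Helpers

variable {M N P Q : Type*}
  [AddCommMonoid M] [AddCommMonoid N] [AddCommMonoid P] [AddCommMonoid Q]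
  [Module k M] [Module k N] [Module k P] [Module k Q]

def aso : (M ⊗[k] N) ⊗[k] P →ₗ[k] M ⊗[k] (N ⊗[k] P) :=
  (TensorProduct.assoc k M N P).toLinearMap

def osa : M ⊗[k] (N ⊗[k] P) →ₗ[k] (M ⊗[k] N) ⊗[k] P :=
  (TensorProduct.assoc k M N P).symm.toLinearMap

def cc : M ⊗[k] N →ₗ[k] N ⊗[k] M := (TensorProduct.comm k M N).toLinearMap

def lc : M ⊗[k] (N ⊗[k] P) →ₗ[k] N ⊗[k] (M ⊗[k] P) :=
  (TensorProduct.leftComm k M N P).toLinearMap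

def tt : (M ⊗[k] N) ⊗[k] (P ⊗[k] Q) →ₗ[k] (M ⊗[k] P) ⊗[k] (N ⊗[k] Q) :=
  (TensorProduct.tensorTensorTensorComm k M N P Q).toLinearMap

end Helpers

section LRCrossed

variable (k)
variable (H U : Type*) [Ring H] [Algebra k H] [AddCommGroup U] [Module k U]

abbrev mH : H ⊗[k] H →ₗ[k] H := LinearMap.mul' k H

def dR : (H ⊗[k] H) ⊗[k] H →ₗ[k] H ⊗[k] H :=
  rTensor H (mH k H) ∘ₗ osa ∘ₗ lTensor H cc ∘ₗ aso

/-- `d ⊗ (g ⊗ i) ↦ (d*g) ⊗ i`. -/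
def dL : H ⊗[k] (H ⊗[k] H) →ₗ[k] H ⊗[k] H :=
  rTensor H (mH k H) ∘ₗ osa

/-- `(g ⊗ i) ⊗ d ↦ g ⊗ (d*i)`. -/
def eR : (H ⊗[k] H) ⊗[k] H →ₗ[k] H ⊗[k] H :=
  lTensor H ((mH k H) ∘ₗ cc) ∘ₗ aso

/-- `d ⊗ (g ⊗ i) ↦ g ⊗ (i*d)`. -/
def eL : H ⊗[k] (H ⊗[k] H) →ₗ[k] H ⊗[k] H :=
  lTensor H ((mH k H) ∘ₗ cc) ∘ₗ lc

/-- `(g ⊗ i) ⊗ (a ⊗ b) ↦ (g*a) ⊗ (b*i)`. -/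
def mulLR : (H ⊗[k] H) ⊗[k] (H ⊗[k] H) →ₗ[k] H ⊗[k] H :=
  TensorProduct.map (mH k H) ((mH k H) ∘ₗ cc) ∘ₗ tt


def w12 : H ⊗[k] (H ⊗[k] H) →ₗ[k] H ⊗[k] H :=
  lTensor H ((mH k H) ∘ₗ cc) ∘ₗ lc ∘ₗ lTensor H cc

def inner12 : (H ⊗[k] H) ⊗[k] (H ⊗[k] H) →ₗ[k] H ⊗[k] H :=
  lTensor H ((mH k H) ∘ₗ cc) ∘ₗ aso ∘ₗ lTensor (H ⊗[k] H) ((mH k H) ∘ₗ cc)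

/-- `(g ⊗ i) ⊗ (b ⊗ (d ⊗ e)) ↦ g * d * e * b * i`. -/
def omegaM : (H ⊗[k] H) ⊗[k] (H ⊗[k] (H ⊗[k] H)) →ₗ[k] H :=
  (mH k H) ∘ₗ
    TensorProduct.map (mH k H) ((mH k H) ∘ₗ rTensor H (mH k H) ∘ₗ cc) ∘ₗ
    tt ∘ₗ lTensor (H ⊗[k] H) (lTensor H cc ∘ₗ lc)

variable {H U}
variable (J : H ⊗[k] U →ₗ[k] U ⊗[k] H) (T : U ⊗[k] H →ₗ[k] U ⊗[k] H)
variable (γ : U ⊗[k] U →ₗ[k] U ⊗[k] (U ⊗[k] H))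
variable (η : U ⊗[k] U →ₗ[k] U ⊗[k] (H ⊗[k] H))

variable (oneU : U)

/-- Axiom (1): `J(h ⊗ 1_U) = 1_U ⊗ h` and `J(1_H ⊗ u) = u ⊗ 1_H`. -/
def LRax1 : Prop :=
  (∀ h : H, J (h ⊗ₜ oneU) = oneU ⊗ₜ h) ∧ (∀ u : U, J ((1 : H) ⊗ₜ u) = u ⊗ₜ (1 : H))

/-- Axiom (2): `T(u ⊗ 1_H) = u ⊗ 1_H` and `T(1_U ⊗ h) = 1_U ⊗ h`. -/
def LRax2 : Prop :=
  (∀ u : U, T (u ⊗ₜ (1 : H)) = u ⊗ₜ (1 : H)) ∧ (∀ h : H, T (oneU ⊗ₜ h) = oneU ⊗ₜ h)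

/-- Axiom (3): `γ(u ⊗ 1_U) = u ⊗ 1_U ⊗ 1_H` and `γ(1_U ⊗ u) = 1_U ⊗ u ⊗ 1_H`. -/
def LRax3 : Prop :=
  (∀ u : U, γ (u ⊗ₜ oneU) = u ⊗ₜ (oneU ⊗ₜ (1 : H))) ∧
  (∀ u : U, γ (oneU ⊗ₜ u) = oneU ⊗ₜ (u ⊗ₜ (1 : H)))

/-- Axiom (4): `η(u ⊗ 1_U) = η(1_U ⊗ u) = u ⊗ 1_H ⊗ 1_H`. -/
def LRax4 : Prop :=
  (∀ u : U, η (u ⊗ₜ oneU) = u ⊗ₜ ((1 : H) ⊗ₜ (1 : H))) ∧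
  (∀ u : U, η (oneU ⊗ₜ u) = u ⊗ₜ ((1 : H) ⊗ₜ (1 : H)))

/-- Axiom (5): `u_J ⊗ (hh')_J = (u_J)_j ⊗ h_j h'_J`. -/
def LRax5 : Prop := ∀ (h h' : H) (u : U),
  J ((h * h') ⊗ₜ u) =
    lTensor U (mH k H) (aso (rTensor H J (osa (h ⊗ₜ (J (h' ⊗ₜ u))))))

/-- Axiom (6): `u_T ⊗ (hh')_T = (u_T)_t ⊗ h_T h'_t`. -/
def LRax6 : Prop := ∀ (u : U) (h h' : H),
  T (u ⊗ₜ (h * h')) =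
    lTensor U ((mH k H) ∘ₗ cc)
      (aso (rTensor H T (osa (lTensor U cc (aso ((T (u ⊗ₜ h)) ⊗ₜ h'))))))

/-- Axiom (7):
`η₁(u_J,u'_j) ⊗ η₂(u_J,u'_j)(h_J)_j ⊗ η₃(u_J,u'_j) = η₁(u,u')_J ⊗ h_J η₂(u,u') ⊗ η₃(u,u')`. -/
def LRax7 : Prop := ∀ (h : H) (u u' : U),
  lTensor U (dR k H)
      (aso (rTensor H η (osa (lTensor U J (aso ((J (h ⊗ₜ u)) ⊗ₜ u'))))))
  = lTensor U (dL k H)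
      (aso (rTensor (H ⊗[k] H) J (osa (h ⊗ₜ (η (u ⊗ₜ u'))))))

/-- Axiom (8):
`η₁(u_t,u'_T) ⊗ η₂(u_t,u'_T) ⊗ (h_T)_t η₃(u_t,u'_T) = η₁(u,u')_T ⊗ η₂(u,u') ⊗ η₃(u,u')h_T`. -/
def LRax8 : Prop := ∀ (u u' : U) (h : H),
  lTensor U (eR k H)
      (aso (rTensor H η (osa (lTensor U cc
        (aso (rTensor U T (osa (lTensor U cc (u ⊗ₜ (T (u' ⊗ₜ h)))))))))))
  = lTensor U (eL k H)
      (aso (rTensor (H ⊗[k] H) T (osa (lTensor U cc (aso ((η (u ⊗ₜ u')) ⊗ₜ h))))))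

/-- Axiom (9). -/
def LRax9 : Prop := ∀ (u u' u'' : U),
  lTensor U (mulLR k H)
      (aso (rTensor (H ⊗[k] H) η (osa (lTensor U (aso (P := H))
        ((lTensor U (rTensor H J ∘ₗ osa ∘ₗ lTensor H cc ∘ₗ aso))
          (aso ((η (u ⊗ₜ u')) ⊗ₜ u'')))))))
  = lTensor U ((mulLR k H) ∘ₗ lTensor (H ⊗[k] H) cc)
      (aso (rTensor (H ⊗[k] H) η (tt (rTensor (U ⊗[k] H) T
        (osa (lTensor U (lc ∘ₗ lTensor U cc) (u ⊗ₜ (η (u' ⊗ₜ u'')))))))))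


def qJ : (U ⊗[k] H) ⊗[k] H →ₗ[k] U ⊗[k] H :=
  lTensor U (mH k H) ∘ₗ aso ∘ₗ rTensor H J ∘ₗ osa ∘ₗ lc ∘ₗ lTensor U cc ∘ₗ aso

/-- Axiom (10). -/
def LRax10 : Prop := ∀ (u u' : U) (h : H),
  lTensor U (lTensor U ((mH k H) ∘ₗ cc))
      (aso (tt (rTensor (U ⊗[k] H) T (osa (lTensor U cc
        (aso (rTensor H γ (osa (u ⊗ₜ (J (h ⊗ₜ u')))))))))))
  = lTensor U (qJ k J)
      (aso (rTensor H γ (osa (lTensor U cc (aso ((T (u ⊗ₜ h)) ⊗ₜ u'))))))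

def psi11 : (U ⊗[k] H) ⊗[k] (H ⊗[k] H) →ₗ[k] U ⊗[k] (H ⊗[k] H) :=
  lTensor U (rTensor H (mH k H) ∘ₗ osa) ∘ₗ aso

def chainX : (U ⊗[k] H) ⊗[k] (U ⊗[k] H) →ₗ[k] U ⊗[k] (H ⊗[k] H) :=
  (lTensor U ((dR k H) ∘ₗ lTensor (H ⊗[k] H) (mH k H))) ∘ₗ aso ∘ₗ
    rTensor (H ⊗[k] H) η ∘ₗ rTensor (H ⊗[k] H) cc ∘ₗ tt ∘ₗ
    lTensor (U ⊗[k] H) cc ∘ₗ rTensor (H ⊗[k] U) J ∘ₗ rTensor (H ⊗[k] U) cc ∘ₗ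
    tt ∘ₗ lTensor (U ⊗[k] H) cc

/-- Axiom (11). -/
def LRax11 : Prop := ∀ (u u' u'' : U),
  lTensor U (psi11 k)
      (aso (tt (rTensor ((U ⊗[k] H) ⊗[k] H) T (tt (rTensor (H ⊗[k] H) γ
        (osa (u ⊗ₜ (η (u' ⊗ₜ u'')))))))))
  = lTensor U (chainX k J η)
      (aso (rTensor (U ⊗[k] H) γ (osa (lTensor U cc
        (aso ((γ (u ⊗ₜ u')) ⊗ₜ u''))))))

def chain12 : (U ⊗[k] H) ⊗[k] (H ⊗[k] H) →ₗ[k] U ⊗[k] (H ⊗[k] H) :=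
  (lTensor U (w12 k H)) ∘ₗ aso ∘ₗ tt ∘ₗ rTensor (H ⊗[k] H) J ∘ₗ
    rTensor (H ⊗[k] H) cc ∘ₗ tt ∘ₗ lTensor (U ⊗[k] H) cc

def big12 : (H ⊗[k] H) ⊗[k] (H ⊗[k] (U ⊗[k] H)) →ₗ[k] U ⊗[k] (H ⊗[k] H) :=
  lTensor U (inner12 k H) ∘ₗ lc ∘ₗ lTensor (H ⊗[k] H) lc

/-- Axiom (12). -/
def LRax12 : Prop := ∀ (u u' u'' : U),
  lTensor U (chain12 k J)
      (aso (rTensor (H ⊗[k] H) γ (osa (lTensor U cc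
        (aso ((η (u ⊗ₜ u')) ⊗ₜ u''))))))
  = lTensor U (big12 k)
      (aso (rTensor (H ⊗[k] (U ⊗[k] H)) η (tt (lTensor (U ⊗[k] H) cc
        (rTensor ((U ⊗[k] H) ⊗[k] U) T (tt (lTensor (U ⊗[k] (U ⊗[k] H)) cc
          (rTensor (U ⊗[k] H) γ (osa (lTensor U lc (u ⊗ₜ (γ (u' ⊗ₜ u'')))))))))))))

def w13 : H ⊗[k] (U ⊗[k] H) →ₗ[k] U ⊗[k] H :=
  lTensor U ((mH k H) ∘ₗ cc) ∘ₗ lc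

def xi2 : H ⊗[k] (U ⊗[k] H) →ₗ[k] U ⊗[k] H :=
  lTensor U (mH k H) ∘ₗ aso ∘ₗ rTensor H J ∘ₗ osa

def xi : H ⊗[k] (U ⊗[k] (U ⊗[k] H)) →ₗ[k] U ⊗[k] (U ⊗[k] H) :=
  lTensor U (xi2 k J) ∘ₗ lc

def rho : (U ⊗[k] H) ⊗[k] U →ₗ[k] (U ⊗[k] (U ⊗[k] H)) ⊗[k] H :=
  rTensor H γ ∘ₗ osa ∘ₗ lTensor U cc ∘ₗ aso

def chainR : ((U ⊗[k] (U ⊗[k] H)) ⊗[k] H) ⊗[k] H →ₗ[k] (U ⊗[k] H) ⊗[k] (U ⊗[k] H) :=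
  tt ∘ₗ lTensor (U ⊗[k] U) cc ∘ₗ
    lTensor (U ⊗[k] U) (rTensor H ((mH k H) ∘ₗ cc) ∘ₗ osa) ∘ₗ tt ∘ₗ
    lTensor (U ⊗[k] H) aso ∘ₗ rTensor ((U ⊗[k] H) ⊗[k] H) T ∘ₗ tt ∘ₗ
    lTensor (U ⊗[k] (U ⊗[k] H)) cc ∘ₗ aso

/-- The composite computing the right-hand side of axiom (13). -/
def rhs13 : ((H ⊗[k] (U ⊗[k] U)) ⊗[k] U) ⊗[k] H →ₗ[k]
    (U ⊗[k] (U ⊗[k] H)) ⊗[k] (U ⊗[k] H) :=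
  osa ∘ₗ lTensor U (chainR k T) ∘ₗ aso ∘ₗ
    rTensor H (lTensor U (rho k γ) ∘ₗ aso ∘ₗ rTensor U ((xi k J) ∘ₗ lTensor H γ))

/-- Axiom (13). -/
def LRax13 : Prop := ∀ (u u' u'' : U) (h h' : H),
  rTensor (U ⊗[k] H) (xi k J)
      (osa (h' ⊗ₜ (lTensor (U ⊗[k] (U ⊗[k] H)) (w13 k)
        (aso (rTensor (U ⊗[k] H) (rTensor H γ) (rTensor (U ⊗[k] H) osa
          (osa (u ⊗ₜ (rTensor (U ⊗[k] H) T (osa (lTensor U cc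
            (aso ((γ (u' ⊗ₜ u'')) ⊗ₜ h)))))))))))))
  = rhs13 k J T γ (((h' ⊗ₜ (u ⊗ₜ u')) ⊗ₜ u'') ⊗ₜ h)

/-- The L-R-crossed product multiplication, as a linear map. -/
def lrM : (U ⊗[k] H) ⊗[k] (U ⊗[k] H) →ₗ[k] U ⊗[k] H :=
  lTensor U (omegaM k H) ∘ₗ aso ∘ₗ rTensor (H ⊗[k] (H ⊗[k] H)) η ∘ₗ tt ∘ₗ
    lTensor (U ⊗[k] H) aso ∘ₗ rTensor ((U ⊗[k] H) ⊗[k] H) T ∘ₗ tt ∘ₗ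
    lTensor (U ⊗[k] (U ⊗[k] H)) cc ∘ₗ
    rTensor (H ⊗[k] H) (lTensor U J ∘ₗ lTensor U cc ∘ₗ aso) ∘ₗ tt ∘ₗ
    rTensor (H ⊗[k] H) (osa ∘ₗ γ) ∘ₗ tt

/-- The L-R-crossed product multiplication of two elements of `U ⊗ H`. -/
def lrMul (x y : U ⊗[k] H) : U ⊗[k] H := lrM k J T γ η (x ⊗ₜ y)

end LRCrossed


section SweedlerSums

variable {A B M N P Q R W X Y : Type*}
  [AddCommMonoid A] [Module k A] [AddCommMonoid B] [Module k B]
  [AddCommMonoid M] [Module k M] [AddCommMonoid N] [Module k N]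
  [AddCommMonoid P] [Module k P] [AddCommMonoid Q] [Module k Q]
  [AddCommMonoid R] [Module k R] [AddCommMonoid W] [Module k W]
  [AddCommMonoid X] [Module k X] [AddCommMonoid Y]

theorem exists_multiset_pair (x : M ⊗[k] N) :
    ∃ S : Multiset (M × N), x = (S.map fun p => p.1 ⊗ₜ[k] p.2).sum := by
  induction x using TensorProduct.induction_on with
  | zero => exact ⟨0, by simp⟩
  | tmul a b => exact ⟨{(a, b)}, by simp⟩
  | add x y hx hy =>
    obtain ⟨S, rfl⟩ := hx
    obtain ⟨S', rfl⟩ := hy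
    exact ⟨S + S', by simp⟩

theorem exists_multiset_triple (x : M ⊗[k] (N ⊗[k] P)) :
    ∃ S : Multiset (M × N × P), x = (S.map fun p => p.1 ⊗ₜ[k] (p.2.1 ⊗ₜ[k] p.2.2)).sum := by
  induction x using TensorProduct.induction_on with
  | zero => exact ⟨0, by simp⟩
  | tmul a y =>
    obtain ⟨S, rfl⟩ := exists_multiset_pair y
    refine ⟨S.map fun p => (a, p), ?_⟩
    rw [← TensorProduct.mk_apply, map_multiset_sum]
    simp [Function.comp_def]
  | add x y hx hy =>
    obtain ⟨S, rfl⟩ := hx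
    obtain ⟨S', rfl⟩ := hy
    exact ⟨S + S', by simp⟩

/-- The sum `∑ K f₁(a, b) f₂(a, b)` in Sweedler notation, for a map `f` with values in a
twofold tensor product and an arbitrary function `K`. -/
def sumPair (f : A ⊗[k] B →ₗ[k] M ⊗[k] N) (a : A) (b : B) (K : M → N → W) : W :=
  ((exists_multiset_pair (f (a ⊗ₜ b))).choose.map fun p => K p.1 p.2).sum

/-- The sum `∑ K f₁(a, b) f₂(a, b) f₃(a, b)` in Sweedler notation, for a map `f` with values
in a threefold tensor product and an arbitrary function `K`. -/
def sumTriple (f : A ⊗[k] B →ₗ[k] M ⊗[k] (N ⊗[k] P)) (a : A) (b : B) (K : M → N → P → W) : W :=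
  ((exists_multiset_triple (f (a ⊗ₜ b))).choose.map fun p => K p.1 p.2.1 p.2.2).sum

theorem apply_eq_sumPair (f : A ⊗[k] B →ₗ[k] M ⊗[k] N) (a : A) (b : B) :
    f (a ⊗ₜ b) = sumPair f a b fun m n => m ⊗ₜ[k] n :=
  (exists_multiset_pair (f (a ⊗ₜ b))).choose_spec

theorem apply_eq_sumTriple (f : A ⊗[k] B →ₗ[k] M ⊗[k] (N ⊗[k] P)) (a : A) (b : B) :
    f (a ⊗ₜ b) = sumTriple f a b fun m n p => m ⊗ₜ[k] (n ⊗ₜ[k] p) :=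
  (exists_multiset_triple (f (a ⊗ₜ b))).choose_spec

theorem map_sumPair (L : W →ₗ[k] X) (f : A ⊗[k] B →ₗ[k] M ⊗[k] N) (a : A) (b : B)
    (K : M → N → W) : L (sumPair f a b K) = sumPair f a b fun m n => L (K m n) := by
  simp [sumPair, map_multiset_sum]

theorem map_sumTriple (L : W →ₗ[k] X) (f : A ⊗[k] B →ₗ[k] M ⊗[k] (N ⊗[k] P)) (a : A) (b : B)
    (K : M → N → P → W) :
    L (sumTriple f a b K) = sumTriple f a b fun m n p => L (K m n p) := by
  simp [sumTriple, map_multiset_sum]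

theorem sumPair_tmul (f : A ⊗[k] B →ₗ[k] M ⊗[k] N) (a : A) (b : B)
    (K : M → N → W) (x : X) :
    sumPair f a b K ⊗ₜ[k] x = sumPair f a b fun m n => K m n ⊗ₜ[k] x :=
  map_sumPair ((TensorProduct.mk k W X).flip x) f a b K

theorem tmul_sumPair (f : A ⊗[k] B →ₗ[k] M ⊗[k] N) (a : A) (b : B)
    (K : M → N → W) (x : X) :
    x ⊗ₜ[k] sumPair f a b K = sumPair f a b fun m n => x ⊗ₜ[k] K m n :=
  map_sumPair (TensorProduct.mk k X W x) f a b K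

theorem sumTriple_tmul (f : A ⊗[k] B →ₗ[k] M ⊗[k] (N ⊗[k] P)) (a : A) (b : B)
    (K : M → N → P → W) (x : X) :
    sumTriple f a b K ⊗ₜ[k] x = sumTriple f a b fun m n p => K m n p ⊗ₜ[k] x :=
  map_sumTriple ((TensorProduct.mk k W X).flip x) f a b K

theorem tmul_sumTriple (f : A ⊗[k] B →ₗ[k] M ⊗[k] (N ⊗[k] P)) (a : A) (b : B)
    (K : M → N → P → W) (x : X) :
    x ⊗ₜ[k] sumTriple f a b K = sumTriple f a b fun m n p => x ⊗ₜ[k] K m n p :=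
  map_sumTriple (TensorProduct.mk k X W x) f a b K

theorem sumPair_congr {f : A ⊗[k] B →ₗ[k] M ⊗[k] N} {a : A} {b : B} {K K' : M → N → Y}
    (h : ∀ m n, K m n = K' m n) : sumPair f a b K = sumPair f a b K' := by
  rw [funext₂ h]

theorem sumTriple_congr {f : A ⊗[k] B →ₗ[k] M ⊗[k] (N ⊗[k] P)} {a : A} {b : B}
    {K K' : M → N → P → Y} (h : ∀ m n p, K m n p = K' m n p) :
    sumTriple f a b K = sumTriple f a b K' := by
  rw [funext₃ h]

section Comm

variable {A' B' M' N' P' : Type*}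
  [AddCommMonoid A'] [Module k A'] [AddCommMonoid B'] [Module k B']
  [AddCommMonoid M'] [Module k M'] [AddCommMonoid N'] [Module k N']
  [AddCommMonoid P'] [Module k P']

theorem sumPair_sumPair_comm (f : A ⊗[k] B →ₗ[k] M ⊗[k] N) (a : A) (b : B)
    (g : A' ⊗[k] B' →ₗ[k] M' ⊗[k] N') (a' : A') (b' : B') (K : M → N → M' → N' → Y) :
    (sumPair f a b fun m n => sumPair g a' b' fun m' n' => K m n m' n') =
      sumPair g a' b' fun m' n' => sumPair f a b fun m n => K m n m' n' :=
  Multiset.sum_map_sum_map _ _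

theorem sumPair_sumTriple_comm (f : A ⊗[k] B →ₗ[k] M ⊗[k] N) (a : A) (b : B)
    (g : A' ⊗[k] B' →ₗ[k] M' ⊗[k] (N' ⊗[k] P')) (a' : A') (b' : B')
    (K : M → N → M' → N' → P' → Y) :
    (sumPair f a b fun m n => sumTriple g a' b' fun m' n' p' => K m n m' n' p') =
      sumTriple g a' b' fun m' n' p' => sumPair f a b fun m n => K m n m' n' p' :=
  Multiset.sum_map_sum_map _ _

end Comm

variable (k)

/-- `K` is linear in each of its two arguments. -/
def IsLinearPair (K : M → N → W) : Prop :=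
  (∀ n, IsLinearMap k fun m => K m n) ∧ ∀ m, IsLinearMap k fun n => K m n

/-- `K` is linear in each of its three arguments. -/
def IsLinearTriple (K : M → N → P → W) : Prop :=
  (∀ n p, IsLinearMap k fun m => K m n p) ∧ ∀ m, IsLinearPair k (K m)

/-- `K` is linear in each of its four arguments. -/
def IsLinearQuadruple (K : M → N → P → Q → W) : Prop :=
  (∀ n p q, IsLinearMap k fun m => K m n p q) ∧ ∀ m, IsLinearTriple k (K m)

/-- `K` is linear in each of its five arguments. -/
def IsLinearQuintuple (K : M → N → P → Q → R → W) : Prop :=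
  (∀ n p q r, IsLinearMap k fun m => K m n p q r) ∧ ∀ m, IsLinearQuadruple k (K m)

variable {k}

theorem IsLinearPair.exists_lift {K : M → N → W} (hK : IsLinearPair k K) :
    ∃ Φ : M ⊗[k] N →ₗ[k] W, ∀ m n, Φ (m ⊗ₜ n) = K m n :=
  ⟨TensorProduct.lift (LinearMap.mk₂ k K (fun a b c => (hK.1 c).map_add a b)
    (fun r a c => (hK.1 c).map_smul r a) (fun a b c => (hK.2 a).map_add b c)
    (fun r a c => (hK.2 a).map_smul r c)), fun _ _ => rfl⟩

theorem IsLinearTriple.exists_lift {K : M → N → P → W} (hK : IsLinearTriple k K) :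
    ∃ Φ : M ⊗[k] (N ⊗[k] P) →ₗ[k] W, ∀ m n p, Φ (m ⊗ₜ (n ⊗ₜ p)) = K m n p := by
  choose Φ hΦ using fun m => (hK.2 m).exists_lift
  have hlin : IsLinearMap k Φ :=
    ⟨fun a b => by ext n p; simpa [hΦ] using (hK.1 n p).map_add a b,
      fun r a => by ext n p; simpa [hΦ] using (hK.1 n p).map_smul r a⟩
  exact ⟨TensorProduct.lift (hlin.mk' Φ), fun m n p => hΦ m n p⟩

theorem IsLinearQuadruple.exists_lift {K : M → N → P → Q → W} (hK : IsLinearQuadruple k K) :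
    ∃ Φ : M ⊗[k] (N ⊗[k] (P ⊗[k] Q)) →ₗ[k] W,
      ∀ m n p q, Φ (m ⊗ₜ (n ⊗ₜ (p ⊗ₜ q))) = K m n p q := by
  choose Φ hΦ using fun m => (hK.2 m).exists_lift
  have hlin : IsLinearMap k Φ :=
    ⟨fun a b => by ext n p q; simpa [hΦ] using (hK.1 n p q).map_add a b,
      fun r a => by ext n p q; simpa [hΦ] using (hK.1 n p q).map_smul r a⟩
  exact ⟨TensorProduct.lift (hlin.mk' Φ), fun m n p q => hΦ m n p q⟩

theorem IsLinearQuintuple.exists_lift {K : M → N → P → Q → R → W}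
    (hK : IsLinearQuintuple k K) :
    ∃ Φ : M ⊗[k] (N ⊗[k] (P ⊗[k] (Q ⊗[k] R))) →ₗ[k] W,
      ∀ m n p q r, Φ (m ⊗ₜ (n ⊗ₜ (p ⊗ₜ (q ⊗ₜ r)))) = K m n p q r := by
  choose Φ hΦ using fun m => (hK.2 m).exists_lift
  have hlin : IsLinearMap k Φ :=
    ⟨fun a b => by ext n p q r; simpa [hΦ] using (hK.1 n p q r).map_add a b,
      fun c a => by ext n p q r; simpa [hΦ] using (hK.1 n p q r).map_smul c a⟩
  exact ⟨TensorProduct.lift (hlin.mk' Φ), fun m n p q r => hΦ m n p q r⟩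

theorem isLinearMap_id' : IsLinearMap k fun x : X => x := ⟨fun _ _ => rfl, fun _ _ => rfl⟩

theorem isLinearMap_tmul_left {L : X → M} (hL : IsLinearMap k L) (n : N) :
    IsLinearMap k fun x => L x ⊗ₜ[k] n :=
  (((TensorProduct.mk k M N).flip n) ∘ₗ hL.mk' L).isLinear

theorem isLinearMap_tmul_right {L : X → N} (hL : IsLinearMap k L) (m : M) :
    IsLinearMap k fun x => m ⊗ₜ[k] L x :=
  ((TensorProduct.mk k M N m) ∘ₗ hL.mk' L).isLinear

theorem isLinearMap_mul_left {H : Type*} [Ring H] [Algebra k H] {L : X → H}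
    (hL : IsLinearMap k L) (h : H) : IsLinearMap k fun x => L x * h :=
  (LinearMap.mulRight k h ∘ₗ hL.mk' L).isLinear

theorem isLinearMap_mul_right {H : Type*} [Ring H] [Algebra k H] {L : X → H}
    (hL : IsLinearMap k L) (h : H) : IsLinearMap k fun x => h * L x :=
  (LinearMap.mulLeft k h ∘ₗ hL.mk' L).isLinear

theorem isLinearMap_sumPair_body {f : A ⊗[k] B →ₗ[k] M ⊗[k] N} {a : A} {b : B}
    {K : X → M → N → W} (hK : ∀ m n, IsLinearMap k fun x => K x m n) :
    IsLinearMap k fun x => sumPair f a b fun m n => K x m n :=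
  ⟨fun x y => by simp [sumPair, (hK _ _).map_add],
    fun r x => by simp [sumPair, (hK _ _).map_smul, Multiset.smul_sum]⟩

theorem isLinearMap_sumTriple_body {f : A ⊗[k] B →ₗ[k] M ⊗[k] (N ⊗[k] P)} {a : A} {b : B}
    {K : X → M → N → P → W} (hK : ∀ m n p, IsLinearMap k fun x => K x m n p) :
    IsLinearMap k fun x => sumTriple f a b fun m n p => K x m n p :=
  ⟨fun x y => by simp [sumTriple, (hK _ _ _).map_add],
    fun r x => by simp [sumTriple, (hK _ _ _).map_smul, Multiset.smul_sum]⟩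

theorem IsLinearPair.exists_sumPair_eq {K : M → N → W} (hK : IsLinearPair k K)
    (f : A ⊗[k] B →ₗ[k] M ⊗[k] N) :
    ∃ Φ : A ⊗[k] B →ₗ[k] W, ∀ a b, sumPair f a b K = Φ (a ⊗ₜ b) := by
  obtain ⟨Φ, hΦ⟩ := hK.exists_lift
  refine ⟨Φ ∘ₗ f, fun a b => ?_⟩
  rw [comp_apply, apply_eq_sumPair, map_sumPair]
  simp only [hΦ]

theorem IsLinearTriple.exists_sumTriple_eq {K : M → N → P → W} (hK : IsLinearTriple k K)
    (f : A ⊗[k] B →ₗ[k] M ⊗[k] (N ⊗[k] P)) :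
    ∃ Φ : A ⊗[k] B →ₗ[k] W, ∀ a b, sumTriple f a b K = Φ (a ⊗ₜ b) := by
  obtain ⟨Φ, hΦ⟩ := hK.exists_lift
  refine ⟨Φ ∘ₗ f, fun a b => ?_⟩
  rw [comp_apply, apply_eq_sumTriple, map_sumTriple]
  simp only [hΦ]

theorem isLinearMap_sumPair_left {f : A ⊗[k] B →ₗ[k] M ⊗[k] N} {L : X → A} {b : B}
    {K : M → N → W} (hL : IsLinearMap k L) (hK : IsLinearPair k K) :
    IsLinearMap k fun x => sumPair f (L x) b K := by
  obtain ⟨Φ, hΦ⟩ := hK.exists_sumPair_eq f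
  simp only [hΦ]
  exact (Φ ∘ₗ (isLinearMap_tmul_left hL b).mk' _).isLinear

theorem isLinearMap_sumPair_right {f : A ⊗[k] B →ₗ[k] M ⊗[k] N} {L : X → B} {a : A}
    {K : M → N → W} (hL : IsLinearMap k L) (hK : IsLinearPair k K) :
    IsLinearMap k fun x => sumPair f a (L x) K := by
  obtain ⟨Φ, hΦ⟩ := hK.exists_sumPair_eq f
  simp only [hΦ]
  exact (Φ ∘ₗ (isLinearMap_tmul_right hL a).mk' _).isLinear

theorem isLinearMap_sumTriple_left {f : A ⊗[k] B →ₗ[k] M ⊗[k] (N ⊗[k] P)} {L : X → A} {b : B}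
    {K : M → N → P → W} (hL : IsLinearMap k L) (hK : IsLinearTriple k K) :
    IsLinearMap k fun x => sumTriple f (L x) b K := by
  obtain ⟨Φ, hΦ⟩ := hK.exists_sumTriple_eq f
  simp only [hΦ]
  exact (Φ ∘ₗ (isLinearMap_tmul_left hL b).mk' _).isLinear

theorem isLinearMap_sumTriple_right {f : A ⊗[k] B →ₗ[k] M ⊗[k] (N ⊗[k] P)} {L : X → B} {a : A}
    {K : M → N → P → W} (hL : IsLinearMap k L) (hK : IsLinearTriple k K) :
    IsLinearMap k fun x => sumTriple f a (L x) K := by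
  obtain ⟨Φ, hΦ⟩ := hK.exists_sumTriple_eq f
  simp only [hΦ]
  exact (Φ ∘ₗ (isLinearMap_tmul_right hL a).mk' _).isLinear

/-- Proves that an expression in Sweedler notation is multilinear by following the positions
of its arguments. -/
theorem multilinear {p : Prop} (h : p := by
    repeat' first
      | intro _
      | apply And.intro
      | exact isLinearMap_id'
      | apply isLinearMap_sumPair_body
      | apply isLinearMap_sumTriple_body
      | apply isLinearMap_sumPair_left
      | apply isLinearMap_sumPair_right
      | apply isLinearMap_sumTriple_left
      | apply isLinearMap_sumTriple_right
      | apply isLinearMap_tmul_left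
      | apply isLinearMap_tmul_right
      | apply isLinearMap_mul_left
      | apply isLinearMap_mul_right) :
    p := h

section HelperApply

theorem aso_tmul (m : M) (n : N) (p : P) :
    aso ((m ⊗ₜ[k] n) ⊗ₜ[k] p) = m ⊗ₜ[k] (n ⊗ₜ[k] p) := rfl

theorem osa_tmul (m : M) (n : N) (p : P) :
    osa (m ⊗ₜ[k] (n ⊗ₜ[k] p)) = (m ⊗ₜ[k] n) ⊗ₜ[k] p := rfl

theorem cc_tmul (m : M) (n : N) : cc (m ⊗ₜ[k] n) = n ⊗ₜ[k] m := rfl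

theorem lc_tmul (m : M) (n : N) (p : P) :
    lc (m ⊗ₜ[k] (n ⊗ₜ[k] p)) = n ⊗ₜ[k] (m ⊗ₜ[k] p) := rfl

theorem tt_tmul (m : M) (n : N) (p : P) (q : Q) :
    tt ((m ⊗ₜ[k] n) ⊗ₜ[k] (p ⊗ₜ[k] q)) = (m ⊗ₜ[k] p) ⊗ₜ[k] (n ⊗ₜ[k] q) := rfl

end HelperApply

section SweedlerAxioms

variable {H U : Type*} [Ring H] [Algebra k H] [AddCommGroup U] [Module k U]
variable {J : H ⊗[k] U →ₗ[k] U ⊗[k] H} {T : U ⊗[k] H →ₗ[k] U ⊗[k] H}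
variable {γ : U ⊗[k] U →ₗ[k] U ⊗[k] (U ⊗[k] H)}
variable {η : U ⊗[k] U →ₗ[k] U ⊗[k] (H ⊗[k] H)}

attribute [local simp] aso_tmul osa_tmul cc_tmul lc_tmul tt_tmul sumPair_tmul tmul_sumPair
  sumTriple_tmul tmul_sumTriple map_sumPair map_sumTriple

theorem LRax5.sumPair_mul (hax : LRax5 k J) (h h' : H) (u : U) {K : U → H → W}
    (hK : IsLinearPair k K) :
    sumPair J (h * h') u K =
      sumPair J h' u fun u₁ h'₁ => sumPair J h u₁ fun u₂ h₁ => K u₂ (h₁ * h'₁) := by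
  obtain ⟨Φ, hΦ⟩ := hK.exists_lift
  simpa [hΦ, apply_eq_sumPair J] using congrArg Φ (hax h h' u)

theorem LRax6.sumPair_mul (hax : LRax6 k T) (u : U) (h h' : H) {K : U → H → W}
    (hK : IsLinearPair k K) :
    sumPair T u (h * h') K =
      sumPair T u h fun u₁ h₁ => sumPair T u₁ h' fun u₂ h'₁ => K u₂ (h₁ * h'₁) := by
  obtain ⟨Φ, hΦ⟩ := hK.exists_lift
  simpa [hΦ, apply_eq_sumPair T] using congrArg Φ (hax u h h')

theorem LRax7.sumPair_eq (hax : LRax7 k J η) (h : H) (u u' : U) {K : U → H → H → W}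
    (hK : IsLinearTriple k K) :
    (sumPair J h u fun u₁ h₁ => sumPair J h₁ u' fun u'₁ h₂ =>
        sumTriple η u₁ u'₁ fun x y z => K x (y * h₂) z) =
      sumTriple η u u' fun x y z => sumPair J h x fun x₁ h₁ => K x₁ (h₁ * y) z := by
  obtain ⟨Φ, hΦ⟩ := hK.exists_lift
  simpa [hΦ, apply_eq_sumPair J, apply_eq_sumTriple η, dR, dL] using congrArg Φ (hax h u u')

theorem LRax8.sumPair_eq (hax : LRax8 k T η) (u u' : U) (h : H) {K : U → H → H → W}
    (hK : IsLinearTriple k K) :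
    (sumPair T u' h fun u'₁ h₁ => sumPair T u h₁ fun u₁ h₂ =>
        sumTriple η u₁ u'₁ fun x y z => K x y (h₂ * z)) =
      sumTriple η u u' fun x y z => sumPair T x h fun x₁ h₁ => K x₁ y (z * h₁) := by
  obtain ⟨Φ, hΦ⟩ := hK.exists_lift
  simpa [hΦ, apply_eq_sumPair T, apply_eq_sumTriple η, eR, eL] using congrArg Φ (hax u u' h)

theorem LRax9.sumTriple_eq (hax : LRax9 k J T η) (u u' u'' : U) {K : U → H → H → W}
    (hK : IsLinearTriple k K) :
    (sumTriple η u u' fun x y z => sumPair J y u'' fun v y₁ =>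
        sumTriple η x v fun x' y' z' => K x' (y' * y₁) (z * z')) =
      sumTriple η u' u'' fun x y z => sumPair T u z fun u₁ z₁ =>
        sumTriple η u₁ x fun x' y' z' => K x' (y' * y) (z₁ * z') := by
  obtain ⟨Φ, hΦ⟩ := hK.exists_lift
  simpa [hΦ, apply_eq_sumPair J, apply_eq_sumPair T, apply_eq_sumTriple η, mulLR]
    using congrArg Φ (hax u u' u'')

theorem LRax10.sumPair_eq (hax : LRax10 k J T γ) (u u' : U) (h : H) {K : U → U → H → W}
    (hK : IsLinearTriple k K) :
    (sumPair J h u' fun u'₁ h₁ => sumTriple γ u u'₁ fun a b c =>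
        sumPair T a h₁ fun a₁ h₂ => K a₁ b (c * h₂)) =
      sumPair T u h fun u₁ h₁ => sumTriple γ u₁ u' fun a b c =>
        sumPair J h₁ b fun b₁ h₂ => K a b₁ (h₂ * c) := by
  obtain ⟨Φ, hΦ⟩ := hK.exists_lift
  simpa [hΦ, apply_eq_sumPair J, apply_eq_sumPair T, apply_eq_sumTriple γ, qJ]
    using congrArg Φ (hax u u' h)

theorem LRax11.sumTriple_eq (hax : LRax11 k J T γ η) (u u' u'' : U) {K : U → U → H → H → W}
    (hK : IsLinearQuadruple k K) :
    (sumTriple η u' u'' fun x y z => sumTriple γ u x fun a b c =>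
        sumPair T a y fun a₁ y₁ => K a₁ b (c * y₁) z) =
      sumTriple γ u u' fun a b c => sumTriple γ a u'' fun r s t =>
        sumPair J c s fun s₁ c₁ => sumTriple η b s₁ fun x y z => K r x (y * c₁ * t) z := by
  obtain ⟨Φ, hΦ⟩ := hK.exists_lift
  simpa [hΦ, apply_eq_sumPair J, apply_eq_sumPair T, apply_eq_sumTriple γ,
    apply_eq_sumTriple η, psi11, chainX, dR, mul_assoc] using congrArg Φ (hax u u' u'')

theorem LRax12.sumTriple_eq (hax : LRax12 k J T γ η) (u u' u'' : U) {K : U → U → H → H → W}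
    (hK : IsLinearQuadruple k K) :
    (sumTriple η u u' fun x y z => sumTriple γ x u'' fun a b c =>
        sumPair J z b fun b₁ z₁ => K a b₁ y (z₁ * c)) =
      sumTriple γ u' u'' fun d e f => sumTriple γ u e fun a b c =>
        sumPair T a f fun a₁ f₁ => sumTriple η a₁ d fun x y z => K x b y (c * f₁ * z) := by
  obtain ⟨Φ, hΦ⟩ := hK.exists_lift
  simpa [hΦ, apply_eq_sumPair J, apply_eq_sumPair T, apply_eq_sumTriple γ,
    apply_eq_sumTriple η, chain12, w12, big12, inner12, mul_assoc]
    using congrArg Φ (hax u u' u'')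

theorem LRax13.sumTriple_eq (hax : LRax13 k J T γ) (u u' u'' : U) (h h' : H)
    {K : U → U → H → U → H → W} (hK : IsLinearQuintuple k K) :
    (sumTriple γ u' u'' fun p q w => sumPair T p h fun p₁ h₁ => sumTriple γ u p₁ fun a b c =>
        sumPair J h' b fun b₁ h'₁ => K a b₁ (h'₁ * c) q (w * h₁)) =
      sumTriple γ u u' fun a b c => sumPair J h' b fun b₁ h'₁ =>
        sumTriple γ b₁ u'' fun d e f => sumPair T d h fun d₁ h₁ =>
          K a d₁ (h'₁ * c) e (f * h₁) := by
  obtain ⟨Φ, hΦ⟩ := hK.exists_lift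
  simpa [hΦ, apply_eq_sumPair J, apply_eq_sumPair T, apply_eq_sumTriple γ, xi, xi2, w13, rhs13,
    rho, chainR] using congrArg (Φ ∘ₗ lTensor U aso ∘ₗ aso) (hax u u' u'' h h')

theorem lrM_tmul (u u' : U) (h h' : H) :
    lrM k J T γ η ((u ⊗ₜ h) ⊗ₜ (u' ⊗ₜ h')) =
      sumTriple γ u u' fun a b c => sumPair T a h' fun a₁ h'₁ => sumPair J h b fun b₁ h₁ =>
        sumTriple η a₁ b₁ fun x y z => x ⊗ₜ[k] (y * h₁ * c * h'₁ * z) := by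
  simp [apply_eq_sumPair J, apply_eq_sumPair T, apply_eq_sumTriple γ,
    apply_eq_sumTriple η, lrM, omegaM, mul_assoc, sumPair_sumPair_comm J h]

set_option maxHeartbeats 2000000 in
/-- Associativity of the L-R-crossed product multiplication on elementary tensors, written in
Sweedler notation. -/
theorem sumTriple_mul_assoc (hax5 : LRax5 k J) (hax6 : LRax6 k T)
    (hax7 : LRax7 k J η) (hax8 : LRax8 k T η) (hax9 : LRax9 k J T η)
    (hax10 : LRax10 k J T γ) (hax11 : LRax11 k J T γ η) (hax12 : LRax12 k J T γ η)
    (hax13 : LRax13 k J T γ) (u u' u'' : U) (h h' h'' : H) :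
    (sumTriple γ u u' fun a b c => sumPair T a h' fun a₁ g' => sumPair J h b fun b₁ g =>
      sumTriple η a₁ b₁ fun x y z => sumTriple γ x u'' fun d e f => sumPair T d h'' fun d₁ i =>
      sumPair J (y * g * c * g' * z) e fun e₁ m => sumTriple η d₁ e₁ fun x' y' z' =>
      x' ⊗ₜ[k] (y' * m * f * i * z')) =
      sumTriple γ u' u'' fun p q w => sumPair T p h'' fun p₁ v => sumPair J h' q fun q₁ g' =>
      sumTriple η p₁ q₁ fun x y z => sumTriple γ u x fun a b c =>
      sumPair T a (y * g' * w * v * z) fun a₁ l => sumPair J h b fun b₁ h₁ =>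
      sumTriple η a₁ b₁ fun x' y' z' => x' ⊗ₜ[k] (y' * h₁ * c * l * z') := by
  calc
    _ = sumTriple γ u u' fun a b c => sumPair T a h' fun a₁ g' => sumPair J h b fun b₁ g =>
      sumTriple η a₁ b₁ fun x y z => sumTriple γ x u'' fun d e f => sumPair J z e fun e₁ z₁ =>
      sumPair T d h'' fun d₁ i => sumPair J (y * g * c * g') e₁ fun e₂ m =>
      sumTriple η d₁ e₂ fun x' y' z' => x' ⊗ₜ[k] (y' * m * (z₁ * f) * i * z') := by
      refine sumTriple_congr fun a b c => sumPair_congr fun a₁ g' => sumPair_congr fun b₁ g =>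
        sumTriple_congr fun x y z => sumTriple_congr fun d e f => ?_
      rw [sumPair_sumPair_comm T d h'', hax5.sumPair_mul _ z e]
      swap
      · exact multilinear
      simp only [sumPair_sumPair_comm T d h'', mul_assoc]
    _ = sumTriple γ u u' fun a b c => sumPair T a h' fun a₁ g' => sumPair J h b fun b₁ g =>
      sumTriple γ b₁ u'' fun d e f => sumTriple γ a₁ e fun r s t => sumPair T r f fun r₁ f₁ =>
      sumTriple η r₁ d fun x y z => sumPair T x h'' fun x₁ i =>
      sumPair J (y * g * c * g') s fun s₁ m => sumTriple η x₁ s₁ fun x' y' z' =>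
      x' ⊗ₜ[k] (y' * m * (t * f₁ * z) * i * z') := by
      refine sumTriple_congr fun a b c => sumPair_congr fun a₁ g' => sumPair_congr fun b₁ g =>
        ?_
      simpa only [mul_assoc] using hax12.sumTriple_eq a₁ b₁ u''
        (K := fun d e y w =>
          sumPair T d h'' fun d₁ i => sumPair J (y * g * c * g') e fun e₁ m =>
                sumTriple η d₁ e₁ fun x' y' z' => x' ⊗ₜ[k] (y' * m * w * i * z'))
        multilinear
    _ = sumTriple γ u u' fun a b c => sumPair T a h' fun a₁ g' => sumPair J h b fun b₁ g =>
      sumTriple γ b₁ u'' fun d e f => sumTriple γ a₁ e fun r s t => sumPair T r f fun r₁ f₁ =>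
      sumPair T d h'' fun d₁ i => sumPair T r₁ i fun r₂ i₁ => sumTriple η r₂ d₁ fun x y z =>
      sumPair J (y * g * c * g') s fun s₁ m => sumTriple η x s₁ fun x' y' z' =>
      x' ⊗ₜ[k] (y' * m * t * f₁ * (i₁ * z) * z') := by
      refine sumTriple_congr fun a b c => sumPair_congr fun a₁ g' => sumPair_congr fun b₁ g =>
        sumTriple_congr fun d e f => sumTriple_congr fun r s t => sumPair_congr fun r₁ f₁ => ?_
      simpa only [mul_assoc] using (hax8.sumPair_eq r₁ d h''
        (K := fun x y w =>
          sumPair J (y * g * c * g') s fun s₁ m => sumTriple η x s₁ fun x' y' z' =>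
                x' ⊗ₜ[k] (y' * m * t * f₁ * w * z'))
        multilinear).symm
    _ = sumTriple γ u u' fun a b c => sumPair J h b fun b₁ g => sumTriple γ b₁ u'' fun d e f =>
      sumPair T d h'' fun d₁ i => sumPair T a h' fun a₁ g' => sumTriple γ a₁ e fun r s t =>
      sumPair J g' s fun s₁ g₁ => sumPair T r (f * i) fun r₁ l => sumTriple η r₁ d₁ fun x y z =>
      sumPair J (y * g * c) s₁ fun s₂ m => sumTriple η x s₂ fun x' y' z' =>
      x' ⊗ₜ[k] (y' * m * (g₁ * t) * l * z * z') := by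
      refine sumTriple_congr fun a b c => ?_
      simp only [sumPair_sumPair_comm T a h', sumPair_sumTriple_comm T a h']
      refine sumPair_congr fun b₁ g => sumTriple_congr fun d e f => ?_
      simp only [sumPair_sumPair_comm T d h'', sumPair_sumTriple_comm T d h'']
      refine sumPair_congr fun a₁ g' => sumTriple_congr fun r s t => ?_
      rw [sumPair_sumPair_comm T r f, sumPair_sumPair_comm J g' s]
      refine sumPair_congr fun d₁ i => ?_
      rw [sumPair_sumPair_comm J g' s, hax6.sumPair_mul r f i]
      swap
      · exact multilinear
      refine sumPair_congr fun r₁ f₁ => sumPair_congr fun r₂ i₁ => ?_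
      rw [sumPair_sumTriple_comm J g' s]
      refine sumTriple_congr fun x y z => ?_
      rw [hax5.sumPair_mul _ g' s]
      swap
      · exact multilinear
      simp only [mul_assoc]
    _ = sumTriple γ u u' fun a b c => sumPair J h b fun b₁ g => sumTriple γ b₁ u'' fun d e f =>
      sumPair T d h'' fun d₁ i => sumPair J h' e fun e₁ g' => sumTriple γ a e₁ fun r s t =>
      sumPair T r (g' * (f * i)) fun r₁ l => sumTriple η r₁ d₁ fun x y z =>
      sumPair J (y * (g * c)) s fun s₁ m => sumTriple η x s₁ fun x' y' z' =>
      x' ⊗ₜ[k] (y' * m * t * l * z * z') := by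
      refine sumTriple_congr fun a b c => sumPair_congr fun b₁ g => sumTriple_congr fun d e f =>
        sumPair_congr fun d₁ i => ?_
      have h₁ := hax10.sumPair_eq a e h'
        (K := fun r s w =>
          sumPair T r (f * i) fun r₁ l => sumTriple η r₁ d₁ fun x y z =>
                sumPair J (y * g * c) s fun s₁ m => sumTriple η x s₁ fun x' y' z' =>
                x' ⊗ₜ[k] (y' * m * w * l * z * z'))
        multilinear
      simp only [mul_assoc] at h₁ ⊢
      refine h₁.symm.trans (sumPair_congr fun e₁ g' => sumTriple_congr fun r s t => ?_)
      rw [hax6.sumPair_mul r g']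
      swap
      · exact multilinear
      simp only [mul_assoc]
    _ = sumTriple γ u' u'' fun p q w => sumPair T p h'' fun p₁ v => sumTriple γ u p₁ fun a b c =>
      sumPair J h b fun b₁ g => sumPair J h' q fun q₁ g' => sumTriple γ a q₁ fun r s t =>
      sumPair T r (g' * (w * v)) fun r₁ l => sumTriple η r₁ b₁ fun x y z =>
      sumPair J (y * (g * c)) s fun s₁ m => sumTriple η x s₁ fun x' y' z' =>
      x' ⊗ₜ[k] (y' * m * t * l * z * z') := by
      exact (hax13.sumTriple_eq u u' u'' h'' h
        (K := fun a d n e f =>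
          sumPair J h' e fun e₁ g' => sumTriple γ a e₁ fun r s t =>
                sumPair T r (g' * f) fun r₁ l => sumTriple η r₁ d fun x y z =>
                sumPair J (y * n) s fun s₁ m => sumTriple η x s₁ fun x' y' z' =>
                x' ⊗ₜ[k] (y' * m * t * l * z * z'))
        multilinear).symm
    _ = sumTriple γ u' u'' fun p q w => sumPair T p h'' fun p₁ v => sumTriple γ u p₁ fun a b c =>
      sumPair J h b fun b₁ g => sumPair J h' q fun q₁ g' => sumTriple γ a q₁ fun r s t =>
      sumPair J c s fun s₁ c₁ => sumPair J g s₁ fun s₂ n => sumPair T r (g' * (w * v)) fun r₁ l =>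
      sumTriple η r₁ b₁ fun x y z => sumPair J y s₂ fun s₃ y₁ => sumTriple η x s₃ fun x' y' z' =>
      x' ⊗ₜ[k] (y' * y₁ * n * c₁ * t * l * (z * z')) := by
      refine sumTriple_congr fun p q w => sumPair_congr fun p₁ v => sumTriple_congr fun a b c =>
        sumPair_congr fun b₁ g => sumPair_congr fun q₁ g' => sumTriple_congr fun r s t => ?_
      simp only [sumPair_sumPair_comm J g, sumPair_sumTriple_comm J g,
        sumPair_sumPair_comm J c, sumPair_sumTriple_comm J c]
      refine sumPair_congr fun r₁ l => sumTriple_congr fun x y z => ?_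
      rw [← mul_assoc, hax5.sumPair_mul (y * g) c s]
      swap
      · exact multilinear
      refine sumPair_congr fun s₁ c₁ => ?_
      rw [hax5.sumPair_mul y g s₁]
      swap
      · exact multilinear
      simp only [mul_assoc]
    _ = sumTriple γ u' u'' fun p q w => sumPair T p h'' fun p₁ v => sumTriple γ u p₁ fun a b c =>
      sumPair J h b fun b₁ g => sumPair J h' q fun q₁ g' => sumTriple γ a q₁ fun r s t =>
      sumPair J c s fun s₁ c₁ => sumPair J g s₁ fun s₂ n => sumPair T r (g' * (w * v)) fun r₁ l =>
      sumTriple η b₁ s₂ fun x y z => sumPair T r₁ z fun r₂ z₁ => sumTriple η r₂ x fun x' y' z' =>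
      x' ⊗ₜ[k] (y' * y * n * c₁ * t * l * (z₁ * z')) := by
      refine sumTriple_congr fun p q w => sumPair_congr fun p₁ v => sumTriple_congr fun a b c =>
        sumPair_congr fun b₁ g => sumPair_congr fun q₁ g' => sumTriple_congr fun r s t =>
        sumPair_congr fun s₁ c₁ => sumPair_congr fun s₂ n => sumPair_congr fun r₁ l => ?_
      exact hax9.sumTriple_eq r₁ b₁ s₂
        (K := fun x y z => x ⊗ₜ[k] (y * n * c₁ * t * l * z)) multilinear
    _ = sumTriple γ u' u'' fun p q w => sumPair T p h'' fun p₁ v => sumTriple γ u p₁ fun a b c =>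
      sumPair J h' q fun q₁ g' => sumTriple γ a q₁ fun r s t => sumPair J c s fun s₁ c₁ =>
      sumPair J h b fun b₁ g => sumPair J g s₁ fun s₂ n => sumTriple η b₁ s₂ fun x y z =>
      sumPair T r (g' * (w * v) * z) fun r₁ l => sumTriple η r₁ x fun x' y' z' =>
      x' ⊗ₜ[k] (y' * (y * n) * c₁ * t * l * z') := by
      refine sumTriple_congr fun p q w => sumPair_congr fun p₁ v => sumTriple_congr fun a b c =>
        ?_
      simp only [sumPair_sumPair_comm J h b, sumPair_sumTriple_comm J h b]
      refine sumPair_congr fun q₁ g' => sumTriple_congr fun r s t => sumPair_congr fun s₁ c₁ =>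
        sumPair_congr fun b₁ g => sumPair_congr fun s₂ n => ?_
      rw [sumPair_sumTriple_comm T r]
      refine sumTriple_congr fun x y z => ?_
      rw [hax6.sumPair_mul r (g' * (w * v)) z]
      swap
      · exact multilinear
      simp only [mul_assoc]
    _ = sumTriple γ u' u'' fun p q w => sumPair T p h'' fun p₁ v => sumPair J h' q fun q₁ g' =>
      sumTriple γ u p₁ fun a b c => sumTriple γ a q₁ fun r s t => sumPair J c s fun s₁ c₁ =>
      sumTriple η b s₁ fun x y z => sumPair J h x fun x₁ h₁ =>
      sumPair T r (g' * (w * v) * z) fun r₁ l => sumTriple η r₁ x₁ fun x' y' z' =>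
      x' ⊗ₜ[k] (y' * h₁ * (y * c₁ * t) * l * z') := by
      refine sumTriple_congr fun p q w => sumPair_congr fun p₁ v => ?_
      rw [sumPair_sumTriple_comm J h' q]
      refine sumTriple_congr fun a b c => sumPair_congr fun q₁ g' =>
        sumTriple_congr fun r s t => sumPair_congr fun s₁ c₁ => ?_
      simpa only [mul_assoc] using hax7.sumPair_eq h b s₁
        (K := fun x y z =>
          sumPair T r (g' * (w * v) * z) fun r₁ l => sumTriple η r₁ x fun x' y' z' =>
                x' ⊗ₜ[k] (y' * y * c₁ * t * l * z'))
        multilinear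
    _ = sumTriple γ u' u'' fun p q w => sumPair T p h'' fun p₁ v => sumPair J h' q fun q₁ g' =>
      sumTriple η p₁ q₁ fun x y z => sumTriple γ u x fun a b c => sumPair T a y fun a₁ y₁ =>
      sumPair J h b fun b₁ h₁ => sumPair T a₁ (g' * (w * v) * z) fun a₂ l =>
      sumTriple η a₂ b₁ fun x' y' z' => x' ⊗ₜ[k] (y' * h₁ * (c * y₁) * l * z') := by
      refine sumTriple_congr fun p q w => sumPair_congr fun p₁ v => sumPair_congr fun q₁ g' =>
        ?_
      exact (hax11.sumTriple_eq u p₁ q₁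
        (K := fun a b y z =>
          sumPair J h b fun b₁ h₁ => sumPair T a (g' * (w * v) * z) fun a₂ l =>
                sumTriple η a₂ b₁ fun x' y' z' => x' ⊗ₜ[k] (y' * h₁ * y * l * z'))
        multilinear).symm
    _ = sumTriple γ u' u'' fun p q w => sumPair T p h'' fun p₁ v => sumPair J h' q fun q₁ g' =>
      sumTriple η p₁ q₁ fun x y z => sumTriple γ u x fun a b c =>
      sumPair T a (y * g' * w * v * z) fun a₁ l => sumPair J h b fun b₁ h₁ =>
      sumTriple η a₁ b₁ fun x' y' z' => x' ⊗ₜ[k] (y' * h₁ * c * l * z') := by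
      refine sumTriple_congr fun p q w => sumPair_congr fun p₁ v => sumPair_congr fun q₁ g' =>
        sumTriple_congr fun x y z => sumTriple_congr fun a b c => ?_
      simp only [sumPair_sumPair_comm J h b, mul_assoc]
      rw [hax6.sumPair_mul a y]
      swap
      · exact multilinear
      simp only [mul_assoc]

end SweedlerAxioms

end SweedlerSums

/-- Under axioms (5)-(13) (the unit axioms (1)-(4) are not needed), the
L-R-crossed product multiplication on `U ⊗ H` is associative:
`[(u⊗h)(u'⊗h')](u''⊗h'') = (u⊗h)[(u'⊗h')(u''⊗h'')]`. -/
theorem lr_crossed_product_mul_assoc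
    {k : Type*} [Field k] {H U : Type*} [Ring H] [Algebra k H]
    [AddCommGroup U] [Module k U] (oneU : U)
    (J : H ⊗[k] U →ₗ[k] U ⊗[k] H) (T : U ⊗[k] H →ₗ[k] U ⊗[k] H)
    (γ : U ⊗[k] U →ₗ[k] U ⊗[k] (U ⊗[k] H))
    (η : U ⊗[k] U →ₗ[k] U ⊗[k] (H ⊗[k] H))
    (hax5 : LRax5 k J) (hax6 : LRax6 k T)
    (hax7 : LRax7 k J η) (hax8 : LRax8 k T η)
    (hax9 : LRax9 k J T η) (hax10 : LRax10 k J T γ)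
    (hax11 : LRax11 k J T γ η) (hax12 : LRax12 k J T γ η)
    (hax13 : LRax13 k J T γ) :
    ∀ (u u' u'' : U) (h h' h'' : H),
      lrMul k J T γ η (lrMul k J T γ η (u ⊗ₜ h) (u' ⊗ₜ h')) (u'' ⊗ₜ h'') =
        lrMul k J T γ η (u ⊗ₜ h) (lrMul k J T γ η (u' ⊗ₜ h') (u'' ⊗ₜ h'')) := by
  intro u u' u'' h h' h''
  have key := sumTriple_mul_assoc hax5 hax6 hax7 hax8 hax9 hax10 hax11 hax12 hax13 u u' u'' h h' h''
  simpa only [lrMul, lrM_tmul, map_sumPair, map_sumTriple, sumPair_tmul, sumTriple_tmul,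
    tmul_sumPair, tmul_sumTriple, mul_assoc] using key
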